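/- arXiv:1305.2186 — 3 statements merged into one kernel-verified Lean document; each statement's English description precedes it below -/
import Mathlib

section
/- Let p, q ∈ [1,∞] with 1/p + 1/q = 1, and let A be a real M×N matrix. Then there exist vectors u ∈ ℝ^M and v ∈ ℝ^N such that: (a) ‖u‖_p = ‖v‖_q = 1; (b) ⟨u, Av⟩ = ‖Aᵀu‖_p = ‖Av‖_q = ‖A‖_{q→q} = ‖Aᵀ‖_{p→p}, where ‖A‖_{q→q} = max_{x≠0} ‖Ax‖_q/‖x‖_q is the induced ℓ^q operator norm and ‖Aᵀ‖_{p→p} is the induced ℓ^p operator norm of the transpose; and (c) if A is entrywise nonnegative then u and v can be chosen entrywise nonnegative. -/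
open scoped ENNReal

/-- The `ℓ^p` norm of a finitely-indexed family of vectors, `p ∈ [1,∞]`. -/
noncomputable def lpNorm (p : ℝ≥0∞) {ι : Type*} [Fintype ι] {E : Type*}
    [SeminormedAddCommGroup E] (v : ι → E) : ℝ :=
  if p = ∞ then ⨆ i, ‖v i‖ else (∑ i, ‖v i‖ ^ p.toReal) ^ (1 / p.toReal)

/-- The operator norm of a matrix induced by the `ℓ^q` vector norm. -/
noncomputable def opNorm (q : ℝ≥0∞) {m n : Type*} [Fintype m] [Fintype n]
    (A : Matrix m n ℝ) : ℝ :=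
  sSup {c : ℝ | ∃ x : n → ℝ, x ≠ 0 ∧ c = lpNorm q (A.mulVec x) / lpNorm q x}

lemma lpN_eq (p : ℝ≥0∞) [hp : Fact (1 ≤ p)] {ι : Type*} [Fintype ι] (v : ι → ℝ) :
    lpNorm p v = ‖WithLp.toLp p v‖ := by
  unfold lpNorm
  split_ifs with h
  · subst h
    rw [PiLp.norm_eq_ciSup]
  · rw [PiLp.norm_eq_sum (ENNReal.toReal_pos (by have := hp.out; positivity) h)]

lemma lpN_abs (p : ℝ≥0∞) {ι : Type*} [Fintype ι] (v : ι → ℝ) :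
    lpNorm p (fun i => |v i|) = lpNorm p v := by
  unfold lpNorm
  simp

lemma lpN_mono (p : ℝ≥0∞) {ι : Type*} [Fintype ι] (v w : ι → ℝ)
    (h : ∀ i, |v i| ≤ |w i|) : lpNorm p v ≤ lpNorm p w := by
  unfold lpNorm
  split_ifs with hp
  · exact ciSup_mono (Set.finite_range _).bddAbove h
  · apply Real.rpow_le_rpow (by positivity) _ (by positivity)
    apply Finset.sum_le_sum
    intro i _
    exact Real.rpow_le_rpow (by positivity) (h i) (by positivity)

lemma lpN_holder_one {ι : Type*} [Fintype ι] (u w : ι → ℝ) :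
    ∑ i, u i * w i ≤ lpNorm 1 u * lpNorm ∞ w := by
  simp only [lpNorm, ENNReal.one_ne_top, if_false, if_true, ENNReal.toReal_one, Real.rpow_one,
    div_one]
  rw [Finset.sum_mul]
  apply Finset.sum_le_sum
  intro i _
  calc u i * w i ≤ |u i * w i| := le_abs_self _
    _ = ‖u i‖ * ‖w i‖ := abs_mul _ _
    _ ≤ _ := mul_le_mul_of_nonneg_left
      (le_ciSup (f := fun i => ‖w i‖) (Set.finite_range _).bddAbove i) (by positivity)

lemma conj_cases (p q : ℝ≥0∞) (hpq : 1 / p + 1 / q = 1) :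
    (p = 1 ∧ q = ∞) ∨ (p = ∞ ∧ q = 1) ∨
      (p ≠ ∞ ∧ q ≠ ∞ ∧ p.toReal.HolderConjugate q.toReal) := by
  have hc : p.HolderConjugate q := ⟨by simpa using hpq⟩
  by_cases hq : q = ∞
  · subst hq
    left
    simpa using hpq
  by_cases hp : p = ∞
  · subst hp
    right; left
    simpa using hpq
  right; right
  have h1 : p ≠ 1 := by
    rintro rfl
    have : (1:ℝ≥0∞) + 1 / q = 1 + 0 := by simpa using hpq
    have := (ENNReal.add_right_inj ENNReal.one_ne_top).1 this
    simp at this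
    exact hq this
  have hp1 : 1 ≤ p := by
    have : 1 / p ≤ 1 := le_self_add.trans hpq.le
    simpa using this
  refine ⟨hp, hq, ?_⟩
  have h0 : p ≠ 0 := by positivity
  have hq1 : 1 ≤ q := by
    have : 1 / q ≤ 1 := le_add_self.trans hpq.le
    simpa using this
  have hq0 : q ≠ 0 := by positivity
  rw [Real.holderConjugate_iff]
  constructor
  · have : 1 < p := lt_of_le_of_ne hp1 (Ne.symm h1)
    simpa using (ENNReal.toReal_lt_toReal ENNReal.one_ne_top hp).2 this
  · have := congrArg ENNReal.toReal hpq
    rw [ENNReal.toReal_add (by simp [h0]) (by simp [hq0])] at this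
    simpa using this

lemma lpN_holder (p q : ℝ≥0∞) (hpq : 1 / p + 1 / q = 1) {ι : Type*} [Fintype ι] (u w : ι → ℝ) :
    ∑ i, u i * w i ≤ lpNorm p u * lpNorm q w := by
  rcases conj_cases p q hpq with ⟨rfl, rfl⟩ | ⟨rfl, rfl⟩ | ⟨hp, hq, h⟩
  · exact lpN_holder_one u w
  · simpa [mul_comm] using lpN_holder_one w u
  · simp only [lpNorm, hp, hq, if_false]
    exact Real.inner_le_Lp_mul_Lq Finset.univ u w h

lemma lpN_single (p : ℝ≥0∞) [Fact (1 ≤ p)] {ι : Type*} [Fintype ι] [DecidableEq ι] (i : ι)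
    (c : ℝ) : lpNorm p (Pi.single i c) = |c| := by
  rw [lpN_eq]
  have := PiLp.norm_single (p := p) (β := fun _ : ι => ℝ) i c
  simpa using this

lemma lpN_dual_le (p q : ℝ≥0∞) (hpq : 1 / p + 1 / q = 1) {ι : Type*} [Fintype ι] [Nonempty ι]
    (w : ι → ℝ) : ∃ g : ι → ℝ, (∀ i, 0 ≤ g i) ∧ lpNorm p g ≤ 1 ∧
      ∑ i, g i * |w i| = lpNorm q w := by
  classical
  rcases conj_cases p q hpq with ⟨rfl, rfl⟩ | ⟨rfl, rfl⟩ | ⟨hp, hq, h⟩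
  · obtain ⟨i, hi⟩ := exists_eq_ciSup_of_finite (f := fun i => ‖w i‖)
    refine ⟨Pi.single i 1, fun j => ?_, ?_, ?_⟩
    · by_cases h : j = i
      · subst h; simp
      · simp [h]
    · rw [lpN_single]; simp
    · simp only [lpNorm, if_true]
      rw [← hi]
      simp [Pi.single_apply]
  · refine ⟨fun _ => 1, fun _ => zero_le_one, ?_, ?_⟩
    · simp [lpNorm]
    · simp [lpNorm]
  · obtain ⟨⟨g, hg, hgw⟩, -⟩ := NNReal.isGreatest_Lp Finset.univ (fun i => ‖w i‖₊) h.symm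
    refine ⟨fun i => g i, fun i => (g i).2, ?_, ?_⟩
    · simp only [lpNorm, hp, if_false]
      apply Real.rpow_le_one (by positivity) _ (by positivity)
      have hg' : ∑ i, g i ^ p.toReal ≤ 1 := hg
      have := NNReal.coe_le_coe.2 hg'
      push_cast at this
      simpa using this
    · have := congrArg NNReal.toReal hgw
      simp only [lpNorm, hq, if_false]
      push_cast at this
      rw [← this]
      apply Finset.sum_congr rfl
      intro i _
      simp [mul_comm]

lemma lpN_dual (p q : ℝ≥0∞) (hpq : 1 / p + 1 / q = 1) [Fact (1 ≤ p)] [Fact (1 ≤ q)]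
    {ι : Type*} [Fintype ι] [Nonempty ι]
    (w : ι → ℝ) : ∃ u : ι → ℝ, lpNorm p u = 1 ∧ ∑ i, u i * w i = lpNorm q w ∧
      ((∀ i, 0 ≤ w i) → ∀ i, 0 ≤ u i) := by
  classical
  by_cases hw : w = 0
  · subst hw
    obtain ⟨i⟩ := ‹Nonempty ι›
    refine ⟨Pi.single i 1, by rw [lpN_single]; simp, ?_, fun _ j => ?_⟩
    · rw [lpN_eq]; simp
    · by_cases h : j = i
      · subst h; simp
      · simp [h]
  obtain ⟨g, hg0, hg1, hg⟩ := lpN_dual_le p q hpq w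
  have hs : ∑ i, (if 0 ≤ w i then g i else - g i) * w i = lpNorm q w := by
    rw [← hg]
    apply Finset.sum_congr rfl
    intro i _
    split_ifs with h
    · rw [abs_of_nonneg h]
    · rw [abs_of_neg (not_le.1 h)]; ring
  refine ⟨fun i => if 0 ≤ w i then g i else - g i, ?_, hs, fun h i => by simp [h i, hg0 i]⟩
  have hpos : 0 < lpNorm q w := by
    rw [lpN_eq]
    simpa using hw
  apply le_antisymm
  · refine le_trans (lpN_mono p _ g fun i => ?_) hg1
    split_ifs <;> simp
  · have := lpN_holder p q hpq (fun i => if 0 ≤ w i then g i else - g i) w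
    rw [hs] at this
    by_contra! hlt
    nlinarith

lemma lpN_exists_max (q : ℝ≥0∞) [Fact (1 ≤ q)] {M N : Type*} [Fintype M] [Fintype N]
    [Nonempty N] (A : Matrix M N ℝ) : ∃ v : N → ℝ, lpNorm q v = 1 ∧
      ∀ x, lpNorm q x = 1 → lpNorm q (A.mulVec x) ≤ lpNorm q (A.mulVec v) := by
  classical
  obtain ⟨i⟩ := ‹Nonempty N›
  have hne : (Metric.sphere (0 : PiLp q (fun _ : N => ℝ)) 1).Nonempty :=
    ⟨WithLp.toLp q (Pi.single i 1), by
      rw [mem_sphere_zero_iff_norm, ← lpN_eq, lpN_single]; simp⟩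
  have hc : Continuous (fun x : PiLp q (fun _ : N => ℝ) =>
      ‖WithLp.toLp q (A.mulVec (WithLp.ofLp x))‖) := by
    have h1 : Continuous (fun x : PiLp q (fun _ : N => ℝ) => A.mulVec (WithLp.ofLp x)) :=
      Continuous.matrix_mulVec continuous_const (PiLp.continuous_ofLp q _)
    exact ((PiLp.continuous_toLp q _).comp h1).norm
  obtain ⟨v, hv, hmax⟩ := (isCompact_sphere (0 : PiLp q (fun _ : N => ℝ)) 1).exists_isMaxOn
    hne hc.continuousOn
  refine ⟨WithLp.ofLp v, ?_, fun x hx => ?_⟩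
  · rw [lpN_eq]; simpa using hv
  · have := hmax (show WithLp.toLp q x ∈ Metric.sphere (0 : PiLp q (fun _ : N => ℝ)) 1 by
      rw [mem_sphere_zero_iff_norm, ← lpN_eq, hx])
    rw [lpN_eq, lpN_eq]
    simpa using this

lemma lpN_exists_max' (q : ℝ≥0∞) [Fact (1 ≤ q)] {M N : Type*} [Fintype M] [Fintype N]
    [Nonempty N] (A : Matrix M N ℝ) : ∃ v : N → ℝ, lpNorm q v = 1 ∧
      (∀ x, lpNorm q x = 1 → lpNorm q (A.mulVec x) ≤ lpNorm q (A.mulVec v)) ∧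
      ((∀ m n, 0 ≤ A m n) → ∀ n, 0 ≤ v n) := by
  obtain ⟨v, hv, hmax⟩ := lpN_exists_max q A
  by_cases hA : ∀ m n, 0 ≤ A m n
  · refine ⟨fun n => |v n|, by rw [lpN_abs, hv], fun x hx => (hmax x hx).trans ?_,
      fun _ n => abs_nonneg _⟩
    apply lpN_mono
    intro m
    refine le_trans ?_ (le_abs_self _)
    simp only [Matrix.mulVec, dotProduct]
    refine (Finset.abs_sum_le_sum_abs _ _).trans (le_of_eq ?_)
    apply Finset.sum_congr rfl
    intro n _
    rw [abs_mul, abs_of_nonneg (hA m n)]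
  · exact ⟨v, hv, hmax, fun h => absurd h hA⟩

lemma opN_eq (q : ℝ≥0∞) [Fact (1 ≤ q)] {M N : Type*} [Fintype M] [Fintype N]
    (A : Matrix M N ℝ) (v : N → ℝ) (hv : lpNorm q v = 1)
    (hmax : ∀ x, lpNorm q x = 1 → lpNorm q (A.mulVec x) ≤ lpNorm q (A.mulVec v)) :
    opNorm q A = lpNorm q (A.mulVec v) := by
  have hz : v ≠ 0 := by
    rintro rfl
    rw [lpN_eq] at hv
    simp at hv
  apply IsGreatest.csSup_eq
  refine ⟨⟨v, hz, by rw [hv, div_one]⟩, ?_⟩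
  rintro c ⟨x, hx, rfl⟩
  have hpos : 0 < lpNorm q x := by
    rw [lpN_eq]
    simpa using hx
  have hsm : ∀ {ι : Type _} [Fintype ι] (y : ι → ℝ),
      lpNorm q ((lpNorm q x)⁻¹ • y) = (lpNorm q x)⁻¹ * lpNorm q y := by
    intro ι _ y
    rw [lpN_eq q (_ • y), WithLp.toLp_smul, norm_smul, ← lpN_eq, Real.norm_of_nonneg (by positivity)]
  have hsm' : ∀ {ι : Type _} [Fintype ι] (y : ι → ℝ),
      lpNorm q ((lpNorm q x)⁻¹ • y) = (lpNorm q x)⁻¹ * lpNorm q y := by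
    intro ι _ y
    rw [lpN_eq q (_ • y), WithLp.toLp_smul, norm_smul, ← lpN_eq, Real.norm_of_nonneg (by positivity)]
  have := hmax ((lpNorm q x)⁻¹ • x) (by rw [hsm, inv_mul_cancel₀ hpos.ne'])
  rw [Matrix.mulVec_smul, hsm'] at this
  rwa [div_eq_inv_mul]

/-- Generalized singular vectors (Theorem `thm:uAv` of the paper): for conjugate exponents
`p, q ∈ [1,∞]` (`1/p + 1/q = 1`) and any real matrix `A` there are `u`, `v` with
`‖u‖_p = ‖v‖_q = 1`, `⟨u, Av⟩ = ‖Aᵀu‖_p = ‖Av‖_q = ‖A‖_{q→q} = ‖Aᵀ‖_{p→p}`, and, if `A`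
is entrywise nonnegative, `u` and `v` can be chosen entrywise nonnegative. -/
theorem stmt14 (p q : ℝ≥0∞) (hpq : 1 / p + 1 / q = 1)
    {M N : Type*} [Fintype M] [Fintype N] [Nonempty M] [Nonempty N]
    (A : Matrix M N ℝ) :
    ∃ (u : M → ℝ) (v : N → ℝ),
      lpNorm p u = 1 ∧ lpNorm q v = 1 ∧
      (∑ m, u m * A.mulVec v m) = opNorm q A ∧
      lpNorm p (A.transpose.mulVec u) = opNorm q A ∧
      lpNorm q (A.mulVec v) = opNorm q A ∧
      opNorm p A.transpose = opNorm q A ∧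
      ((∀ m n, 0 ≤ A m n) → (∀ m, 0 ≤ u m) ∧ (∀ n, 0 ≤ v n)) := by
  haveI : Fact (1 ≤ p) := ⟨by
    have : 1 / p ≤ 1 := le_self_add.trans hpq.le
    simpa using this⟩
  haveI : Fact (1 ≤ q) := ⟨by
    have : 1 / q ≤ 1 := le_add_self.trans hpq.le
    simpa using this⟩
  have hqp : 1 / q + 1 / p = 1 := by rw [add_comm]; exact hpq
  obtain ⟨v, hv, hmax, hvA⟩ := lpN_exists_max' q A
  have hop := opN_eq q A v hv hmax
  obtain ⟨u, hu, huw, hu0⟩ := lpN_dual p q hpq (A.mulVec v)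
  have hadj : ∀ (y : M → ℝ) (x : N → ℝ),
      ∑ n, x n * A.transpose.mulVec y n = ∑ m, y m * A.mulVec x m := by
    intro y x
    have := Matrix.dotProduct_mulVec y A x
    rw [← Matrix.mulVec_transpose] at this
    rw [dotProduct_comm _ x] at this
    exact this.symm
  have hle : ∀ y, lpNorm p y = 1 → lpNorm p (A.transpose.mulVec y) ≤ opNorm q A := by
    intro y hy
    obtain ⟨x, hx, hxe, -⟩ := lpN_dual q p hqp (A.transpose.mulVec y)
    rw [← hxe, hadj, hop]
    refine (lpN_holder p q hpq _ _).trans ?_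
    rw [hy, one_mul]
    exact hmax x hx
  have hAu : lpNorm p (A.transpose.mulVec u) = opNorm q A := by
    apply le_antisymm (hle u hu)
    rw [hop, ← huw, ← hadj]
    refine (lpN_holder q p hqp _ _).trans ?_
    rw [hv, one_mul]
  refine ⟨u, v, hu, hv, by rw [huw, hop], hAu, hop.symm, ?_, fun hA => ⟨hu0 fun m => ?_, hvA hA⟩⟩
  · rw [opN_eq p A.transpose u hu (fun x hx => hAu ▸ hle x hx), hAu]
  · exact Finset.sum_nonneg fun n _ => mul_nonneg (hA m n) (hvA hA n)
end

section
/- Let q ∈ (1,∞) and let A be an entrywise nonnegative M×N real matrix that is not block diagonal, in the sense that every row and every column of A contains a nonzero entry and the bipartite graph on the row and column indices, with an edge between row m and column n whenever A_{mn} > 0, is connected. Let v ∈ ℝ^N be a nonzero entrywise nonnegative vector maximizing ‖Av‖_q / ‖v‖_q over nonzero vectors. Then every entry of v is strictly positive. -/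
/-- The `ℓ^p` norm with a real exponent `p`. -/
noncomputable def lpNormR (p : ℝ) {ι : Type*} [Fintype ι] {E : Type*}
    [SeminormedAddCommGroup E] (v : ι → E) : ℝ :=
  (∑ i, ‖v i‖ ^ p) ^ (1 / p)

/-- The adjacency relation of the bipartite graph of the nonzero entries of `A`:
row `m` is adjacent to column `n` exactly when `A m n > 0`. -/
def bipAdj {M N : Type*} (A : Matrix M N ℝ) : M ⊕ N → M ⊕ N → Prop
  | Sum.inl m, Sum.inr n => 0 < A m n
  | Sum.inr n, Sum.inl m => 0 < A m n
  | _, _ => False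

/-- A matrix is not block diagonal when every row and every column contains a nonzero
entry and the bipartite graph of its positive entries is connected. -/
def NotBlockDiagonal {M N : Type*} (A : Matrix M N ℝ) : Prop :=
  (∀ m, ∃ n, A m n ≠ 0) ∧ (∀ n, ∃ m, A m n ≠ 0) ∧
    ∀ x y : M ⊕ N, Relation.ReflTransGen (bipAdj A) x y

theorem bern_aux {q : ℝ} (hq : 1 < q) {b s : ℝ} (hb : 0 < b) (hs : 0 ≤ s) :
    b ^ q + q * (b ^ q / b) * s ≤ (b + s) ^ q := by
  have h1 := one_add_mul_self_le_rpow_one_add (s := s / b) (by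
    have : 0 ≤ s / b := by positivity
    linarith) hq.le
  have h2 : b + s = b * (1 + s / b) := by field_simp
  rw [h2, Real.mul_rpow hb.le (by positivity)]
  calc b ^ q + q * (b ^ q / b) * s = b ^ q * (1 + q * (s / b)) := by ring
    _ ≤ _ := by gcongr

theorem sum_ineq {q : ℝ} (hq : 1 < q) {M N : Type*} [Fintype M] [Fintype N]
    (A : Matrix M N ℝ) (v w : N → ℝ)
    (hv : 0 < ∑ i, ‖v i‖ ^ q) (hw : 0 < ∑ i, ‖w i‖ ^ q)
    (h : lpNormR q (A.mulVec w) / lpNormR q w ≤ lpNormR q (A.mulVec v) / lpNormR q v) :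
    (∑ i, ‖A.mulVec w i‖ ^ q) * (∑ i, ‖v i‖ ^ q)
      ≤ (∑ i, ‖A.mulVec v i‖ ^ q) * (∑ i, ‖w i‖ ^ q) := by
  have hF : ∀ u : N → ℝ, 0 ≤ ∑ i, ‖A.mulVec u i‖ ^ q := fun u =>
    Finset.sum_nonneg fun i _ => by positivity
  unfold lpNormR at h
  rw [← Real.div_rpow (hF w) hw.le, ← Real.div_rpow (hF v) hv.le,
    Real.rpow_le_rpow_iff (div_nonneg (hF w) hw.le) (div_nonneg (hF v) hv.le) (by positivity),
    div_le_div_iff₀ hw hv] at h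
  exact h

theorem step_aux (q : ℝ) (hq : 1 < q)
    {M N : Type*} [Fintype M] [Fintype N]
    (A : Matrix M N ℝ) (hA : ∀ m n, 0 ≤ A m n)
    (v : N → ℝ) (hvnn : ∀ n, 0 ≤ v n)
    (hmax : ∀ w : N → ℝ, w ≠ 0 →
      lpNormR q (A.mulVec w) / lpNormR q w ≤ lpNormR q (A.mulVec v) / lpNormR q v)
    (m : M) (n₀ n₁ : N) (h0 : 0 < A m n₀) (h1 : 0 < A m n₁) (hv : 0 < v n₀) : 0 < v n₁ := by
  classical
  by_contra hcon
  have hz : v n₁ = 0 := le_antisymm (not_lt.mp hcon) (hvnn n₁)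
  have hq0 : 0 < q := by linarith
  have hG : 0 < ∑ i, ‖v i‖ ^ q :=
    Finset.sum_pos' (fun i _ => by positivity)
      ⟨n₀, Finset.mem_univ _, Real.rpow_pos_of_pos (by simpa using hv.ne') _⟩
  have hAv : ∀ i, 0 ≤ A.mulVec v i := fun i =>
    Finset.sum_nonneg fun j _ => mul_nonneg (hA i j) (hvnn j)
  have hb : 0 < A.mulVec v m :=
    Finset.sum_pos' (fun j _ => mul_nonneg (hA m j) (hvnn j))
      ⟨n₀, Finset.mem_univ _, mul_pos h0 hv⟩
  have hF : 0 ≤ ∑ i, ‖A.mulVec v i‖ ^ q := Finset.sum_nonneg fun i _ => by positivity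
  set b := A.mulVec v m with hbdef
  set c := q * (b ^ q / b) * A m n₁ with hc
  have hcpos : 0 < c := by positivity
  have key : ∀ t : ℝ, 0 < t → (∑ i, ‖A.mulVec v i‖ ^ q + c * t) * (∑ i, ‖v i‖ ^ q)
      ≤ (∑ i, ‖A.mulVec v i‖ ^ q) * (∑ i, ‖v i‖ ^ q + t ^ q) := by
    intro t ht
    have hwv : ∀ i, A.mulVec (v + Pi.single n₁ t) i = A.mulVec v i + A i n₁ * t := by
      intro i
      rw [Matrix.mulVec_add]
      simp [Matrix.mulVec_single, mul_comm]
    have hwG : ∑ i, ‖(v + Pi.single n₁ t : N → ℝ) i‖ ^ q = ∑ i, ‖v i‖ ^ q + t ^ q := by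
      have : ∀ i, ‖(v + Pi.single n₁ t : N → ℝ) i‖ ^ q
          = ‖v i‖ ^ q + (if i = n₁ then t ^ q else 0) := by
        intro i
        by_cases hi : i = n₁
        · subst hi
          simp [hz, Real.zero_rpow hq0.ne', abs_of_pos ht]
        · simp [hi]
      rw [Finset.sum_congr rfl fun i _ => this i, Finset.sum_add_distrib]
      simp
    have htq : 0 < t ^ q := by positivity
    have hne : v + Pi.single n₁ t ≠ 0 := by
      intro h
      have := congrFun h n₁
      simp [hz] at this
      exact ht.ne' this
    have h := sum_ineq hq A v (v + Pi.single n₁ t) hG (by rw [hwG]; positivity) (hmax _ hne)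
    rw [hwG] at h
    refine le_trans ?_ h
    refine mul_le_mul_of_nonneg_right ?_ hG.le
    have hct : c * t = ∑ i, (if i = m then c * t else 0) := by simp
    rw [hct, ← Finset.sum_add_distrib]
    refine Finset.sum_le_sum fun i _ => ?_
    have hs : 0 ≤ A i n₁ * t := mul_nonneg (hA i n₁) ht.le
    rw [hwv, Real.norm_of_nonneg (hAv i), Real.norm_of_nonneg (add_nonneg (hAv i) hs)]
    by_cases hi : i = m
    · subst hi
      have := bern_aux hq hb hs
      simp only [if_true]
      rw [hc, mul_assoc _ (A i n₁) t]
      exact this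
    · simp only [hi, if_false, add_zero]
      exact Real.rpow_le_rpow (hAv i) (by linarith) hq0.le
  generalize (∑ i, ‖A.mulVec v i‖ ^ q) = F at *
  generalize (∑ i, ‖v i‖ ^ q) = G at *
  have hε : 0 < c * G / (F + 1) := by positivity
  set ε := c * G / (F + 1) with hεd
  have ht : 0 < ε ^ (1 / (q - 1)) := by positivity
  have hk := key _ ht
  have htq : (ε ^ (1 / (q - 1))) ^ q = ε ^ (1 / (q - 1)) * ε := by
    have hq1 : q - 1 ≠ 0 := by linarith
    rw [← Real.rpow_mul hε.le]
    nth_rewrite 3 [← Real.rpow_one ε]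
    rw [← Real.rpow_add hε]
    congr 1
    field_simp
    ring
  rw [htq] at hk
  generalize ε ^ (1 / (q - 1)) = t at *
  have h3 : ε * (F + 1) = c * G := by rw [hεd]; field_simp
  have h4 : t * (c * G) ≤ t * (F * ε) := by nlinarith
  have h5 := le_of_mul_le_mul_left h4 ht
  nlinarith

/-- Perron–Frobenius-type positivity: a nonzero nonnegative maximizer of
`‖Av‖_q / ‖v‖_q` for a nonnegative, not block diagonal matrix `A` and `q ∈ (1,∞)` has
all entries strictly positive. -/
theorem stmt15 (q : ℝ) (hq : 1 < q)
    {M N : Type*} [Fintype M] [Fintype N]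
    (A : Matrix M N ℝ) (hA : ∀ m n, 0 ≤ A m n) (hnb : NotBlockDiagonal A)
    (v : N → ℝ) (hv0 : v ≠ 0) (hvnn : ∀ n, 0 ≤ v n)
    (hmax : ∀ w : N → ℝ, w ≠ 0 →
      lpNormR q (A.mulVec w) / lpNormR q w ≤ lpNormR q (A.mulVec v) / lpNormR q v) :
    ∀ n, 0 < v n := by
  obtain ⟨n₀, hn₀⟩ := Function.ne_iff.mp hv0
  have hpos : 0 < v n₀ := lt_of_le_of_ne (hvnn n₀) (Ne.symm hn₀)
  have main : ∀ y : M ⊕ N, Sum.elim (fun m => ∃ n, 0 < A m n ∧ 0 < v n) (fun n => 0 < v n) y := by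
    intro y
    induction hnb.2.2 (Sum.inr n₀) y with
    | refl => exact hpos
    | @tail a b _ hab ih =>
      rcases a with m | n <;> rcases b with m' | n'
      · exact hab.elim
      · obtain ⟨k, hk, hvk⟩ := ih
        exact step_aux q hq A hA v hvnn hmax m k n' hk hab hvk
      · exact ⟨n, hab, ih⟩
      · exact hab.elim
  exact fun n => main (Sum.inr n)
end

section
/- Let p, q ∈ (1,∞) with 1/p + 1/q = 1, and let A be any entrywise nonnegative M×N real matrix (possibly block diagonal, possibly with zero rows or columns). Then there exist entrywise strictly positive vectors u ∈ ℝ^M and v ∈ ℝ^N such that (Aᵀu)_n ≤ v_n^{q/p} · ‖A‖_{q→q} for all n and (Av)_m ≤ u_m^{p/q} · ‖A‖_{q→q} for all m, where ‖A‖_{q→q} = max_{x≠0} ‖Ax‖_q/‖x‖_q is the induced ℓ^q operator norm. -/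
/-- The operator norm of a matrix induced by the `ℓ^q` vector norm, real exponent `q`. -/
noncomputable def opNormR (q : ℝ) {m n : Type*} [Fintype m] [Fintype n]
    (A : Matrix m n ℝ) : ℝ :=
  sSup {c : ℝ | ∃ x : n → ℝ, x ≠ 0 ∧ c = lpNormR q (A.mulVec x) / lpNormR q x}

theorem aux_tangent (q a b : ℝ) (hq : 1 < q) (ha : 0 ≤ a) (hb : 0 ≤ b) :
    b ^ q + q * b ^ (q - 1) * (a - b) ≤ a ^ q := by
  have hq0 : 0 < q := by linarith
  have hc : q.HolderConjugate (Real.conjExponent q) := Real.HolderConjugate.conjExponent hq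
  have h := Real.young_inequality_of_nonneg ha (Real.rpow_nonneg hb (q - 1)) hc
  have e1 : (b ^ (q - 1)) ^ (Real.conjExponent q) = b ^ q := by
    rw [← Real.rpow_mul hb]
    congr 1
    unfold Real.conjExponent
    have : q - 1 ≠ 0 := by linarith
    field_simp
  have e2 : b ^ (q - 1) * b = b ^ q := by
    rcases hb.eq_or_lt with h0 | h0
    · rw [← h0, Real.zero_rpow hq0.ne']; simp
    · rw [← Real.rpow_add_one h0.ne']; congr 1; ring
  rw [e1] at h
  have h3 : b ^ q / Real.conjExponent q = b ^ q * (q - 1) / q := by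
    unfold Real.conjExponent
    have : q - 1 ≠ 0 := by linarith
    field_simp
  rw [h3, ← add_div, le_div_iff₀ hq0] at h
  nlinarith

theorem aux_op {M N : Type*} [Fintype M] [Fintype N] (q : ℝ) (hq : 1 < q)
    (A : Matrix M N ℝ) :
    0 ≤ opNormR q A ∧ ∀ x : N → ℝ,
      ∑ m, |A.mulVec x m| ^ q ≤ opNormR q A ^ q * ∑ n, |x n| ^ q := by
  have hq0 : 0 < q := by linarith
  have hlp : ∀ {ι : Type _} [Fintype ι] (x : ι → ℝ), 0 ≤ lpNormR q x := by
    intro ι _ x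
    exact Real.rpow_nonneg (Finset.sum_nonneg fun i _ => Real.rpow_nonneg (norm_nonneg _) _) _
  have hlp' : ∀ (x : M → ℝ), 0 ≤ lpNormR q x := by
    intro x
    exact Real.rpow_nonneg (Finset.sum_nonneg fun i _ => Real.rpow_nonneg (norm_nonneg _) _) _
  have hpow : ∀ (x : N → ℝ), lpNormR q x ^ q = ∑ i, |x i| ^ q := by
    intro x
    unfold lpNormR
    rw [← Real.rpow_mul (Finset.sum_nonneg fun i _ => Real.rpow_nonneg (norm_nonneg _) _),
      one_div_mul_cancel hq0.ne', Real.rpow_one]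
    rfl
  have hpow' : ∀ (x : M → ℝ), lpNormR q x ^ q = ∑ i, |x i| ^ q := by
    intro x
    unfold lpNormR
    rw [← Real.rpow_mul (Finset.sum_nonneg fun i _ => Real.rpow_nonneg (norm_nonneg _) _),
      one_div_mul_cancel hq0.ne', Real.rpow_one]
    rfl
  have hcoord : ∀ (x : N → ℝ) n, |x n| ≤ lpNormR q x := by
    intro x n
    rw [← Real.rpow_le_rpow_iff (abs_nonneg _) (hlp x) hq0, hpow]
    exact Finset.single_le_sum (f := fun n => |x n| ^ q)
      (fun i _ => Real.rpow_nonneg (abs_nonneg _) _) (Finset.mem_univ n)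
  have hpos : ∀ x : N → ℝ, x ≠ 0 → 0 < lpNormR q x := by
    intro x hx
    obtain ⟨n, hn⟩ := Function.ne_iff.mp hx
    exact lt_of_lt_of_le (abs_pos.mpr hn) (hcoord x n)
  set B : ℝ := (∑ m, (∑ n, |A m n|) ^ q) ^ (1 / q) with hB
  have hB0 : 0 ≤ ∑ m, (∑ n, |A m n|) ^ q :=
    Finset.sum_nonneg fun m _ => Real.rpow_nonneg (Finset.sum_nonneg fun n _ => abs_nonneg _) _
  have hbd : BddAbove {c : ℝ | ∃ x : N → ℝ, x ≠ 0 ∧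
      c = lpNormR q (A.mulVec x) / lpNormR q x} := by
    refine ⟨B, ?_⟩
    rintro c ⟨x, hx, rfl⟩
    rw [div_le_iff₀ (hpos x hx)]
    rw [← Real.rpow_le_rpow_iff (hlp' _) (mul_nonneg (Real.rpow_nonneg hB0 _) (hlp x)) hq0, hpow',
      Real.mul_rpow (Real.rpow_nonneg hB0 _) (hlp x), ← Real.rpow_mul hB0,
      one_div_mul_cancel hq0.ne', Real.rpow_one, Finset.sum_mul]
    refine Finset.sum_le_sum fun m _ => ?_
    rw [← Real.mul_rpow (Finset.sum_nonneg fun n _ => abs_nonneg _) (hlp x)]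
    refine Real.rpow_le_rpow (abs_nonneg _) ?_ hq0.le
    rw [Finset.sum_mul]
    refine (Finset.abs_sum_le_sum_abs _ _).trans (Finset.sum_le_sum fun n _ => ?_)
    rw [abs_mul]
    exact mul_le_mul_of_nonneg_left (hcoord x n) (abs_nonneg _)
  have h0 : 0 ≤ opNormR q A := by
    refine Real.sSup_nonneg ?_
    rintro c ⟨x, hx, rfl⟩
    exact div_nonneg (hlp' _) (hlp _)
  refine ⟨h0, fun x => ?_⟩
  by_cases hx : x = 0
  · subst hx
    simp [Real.zero_rpow hq0.ne']
  · have h := le_csSup hbd ⟨x, hx, rfl⟩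
    rw [div_le_iff₀ (hpos x hx)] at h
    rw [← hpow, ← hpow', ← Real.mul_rpow h0 (hlp x)]
    exact Real.rpow_le_rpow (hlp' _) h hq0.le

/-- supersolution -/
def AuxSup {M N : Type*} [Fintype M] [Fintype N] (q C : ℝ) (A : Matrix M N ℝ) (v : N → ℝ) : Prop :=
  (∀ n, 0 ≤ v n) ∧ ∀ n, ∑ m, A m n * (A.mulVec v m) ^ (q - 1) ≤ C * v n ^ (q - 1)

theorem aux_mv_nonneg {M N : Type*} [Fintype N] (A : Matrix M N ℝ)
    (hA : ∀ m n, 0 ≤ A m n) (v : N → ℝ) (hv : ∀ n, 0 ≤ v n) (m : M) : 0 ≤ A.mulVec v m :=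
  Finset.sum_nonneg fun n _ => mul_nonneg (hA m n) (hv n)

theorem aux_mv_zero {M N : Type*} [Fintype N] (A : Matrix M N ℝ)
    (hA : ∀ m n, 0 ≤ A m n) (v : N → ℝ) (hv : ∀ n, 0 ≤ v n) (m : M)
    (h : A.mulVec v m = 0) (n : N) : A m n * v n = 0 :=
  (Finset.sum_eq_zero_iff_of_nonneg fun n _ => mul_nonneg (hA m n) (hv n)).mp h n
    (Finset.mem_univ n)

/-- Maximizer among nonneg vectors vanishing on a proper subset. -/
theorem aux_max {M N : Type*} [Fintype M] [Fintype N] (q C : ℝ) (hq : 1 < q)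
    (A : Matrix M N ℝ) (hA : ∀ m n, 0 ≤ A m n)
    (hC : ∀ x : N → ℝ, (∀ n, 0 ≤ x n) → ∑ m, (A.mulVec x m) ^ q ≤ C * ∑ n, x n ^ q)
    (S : Set N) (n0 : N) (hn0 : n0 ∉ S) :
    ∃ x : N → ℝ, (∀ n, 0 ≤ x n) ∧ (∀ n ∈ S, x n = 0) ∧ (∃ n, x n ≠ 0) ∧
      ∀ n, n ∉ S → ∑ m, A m n * (A.mulVec x m) ^ (q - 1) ≤ C * x n ^ (q - 1) := by
  classical
  have hq0 : 0 < q := by linarith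
  let K : Set (N → ℝ) := {x | (∀ n, 0 ≤ x n) ∧ (∀ n ∈ S, x n = 0) ∧ ∑ n, x n ^ q = 1}
  have hcN : Continuous fun x : N → ℝ => ∑ n, x n ^ q :=
    continuous_finsetSum _ fun n _ => (continuous_apply n).rpow_const fun _ => Or.inr hq0.le
  have hcM : Continuous fun x : N → ℝ => ∑ m, (A.mulVec x m) ^ q := by
    refine continuous_finsetSum _ fun m _ => Continuous.rpow_const ?_ fun _ => Or.inr hq0.le
    exact continuous_finsetSum _ fun n _ => continuous_const.mul (continuous_apply n)
  have hKc : IsCompact K := by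
    refine IsCompact.of_isClosed_subset (isCompact_univ_pi (fun _ : N => isCompact_Icc (a := (0:ℝ)) (b := 1))) ?_ ?_
    · have : K = (⋂ n, {x : N → ℝ | 0 ≤ x n}) ∩ ((⋂ n ∈ S, {x : N → ℝ | x n = 0}) ∩
          {x : N → ℝ | ∑ n, x n ^ q = 1}) := by
        ext x; simp [K]
      rw [this]
      refine IsClosed.inter (isClosed_iInter fun n => isClosed_le continuous_const (continuous_apply n)) (IsClosed.inter ?_ (isClosed_eq hcN continuous_const))
      exact isClosed_biInter fun n _ => isClosed_eq (continuous_apply n) continuous_const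
    · rintro x ⟨h1, h2, h3⟩ n _
      refine ⟨h1 n, ?_⟩
      have : x n ^ q ≤ 1 := by
        rw [← h3]
        exact Finset.single_le_sum (f := fun n => x n ^ q)
          (fun i _ => Real.rpow_nonneg (h1 i) _) (Finset.mem_univ n)
      by_contra hlt
      push Not at hlt
      exact absurd this (not_le.mpr (Real.one_lt_rpow hlt hq0))
  have hne : K.Nonempty := by
    refine ⟨Pi.single n0 1, ?_, ?_, ?_⟩
    · intro n
      by_cases h : n = n0
      · subst h; simp
      · simp [h]
    · intro n hn
      have : n ≠ n0 := fun h => hn0 (h ▸ hn)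
      simp [this]
    · rw [Finset.sum_eq_single n0]
      · simp
      · intro b _ hb
        simp [hb, Real.zero_rpow hq0.ne']
      · simp
  obtain ⟨x, ⟨hx0, hxS, hx1⟩, hmax⟩ := hKc.exists_isMaxOn hne hcM.continuousOn
  set τ : ℝ := ∑ m, (A.mulVec x m) ^ q with hτ
  have hτC : τ ≤ C := by have := hC x hx0; rwa [hx1, mul_one] at this
  have hτ0 : 0 ≤ τ := Finset.sum_nonneg fun m _ => Real.rpow_nonneg (aux_mv_nonneg A hA x hx0 m) _
  have hom : ∀ y : N → ℝ, (∀ n, 0 ≤ y n) → (∀ n ∈ S, y n = 0) → 0 < ∑ n, y n ^ q →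
      ∑ m, (A.mulVec y m) ^ q ≤ τ * ∑ n, y n ^ q := by
    intro y hy hyS hpos
    set s := ∑ n, y n ^ q with hs
    set c : ℝ := s ^ (-(1 / q)) with hc
    have hc0 : 0 < c := Real.rpow_pos_of_pos hpos _
    have hcq : c ^ q = s⁻¹ := by
      rw [hc, ← Real.rpow_mul hpos.le, neg_mul, one_div_mul_cancel hq0.ne', Real.rpow_neg_one]
    have hmem : c • y ∈ K := by
      refine ⟨fun n => mul_nonneg hc0.le (hy n), fun n hn => by simp [hyS n hn], ?_⟩
      have : ∀ n, (c • y) n ^ q = c ^ q * y n ^ q := fun n => by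
        rw [Pi.smul_apply, smul_eq_mul, Real.mul_rpow hc0.le (hy n)]
      simp_rw [this]
      rw [← Finset.mul_sum, hcq, inv_mul_cancel₀ hpos.ne']
    have h := hmax hmem
    simp only [Set.mem_ofPred_eq] at h
    have h2 : ∀ m, (A.mulVec (c • y) m) ^ q = c ^ q * (A.mulVec y m) ^ q := fun m => by
      rw [Matrix.mulVec_smul, Pi.smul_apply, smul_eq_mul, Real.mul_rpow hc0.le (aux_mv_nonneg A hA y hy m)]
    simp_rw [h2] at h
    rw [← Finset.mul_sum, hcq, inv_mul_le_iff₀ hpos] at h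
    linarith
  refine ⟨x, hx0, hxS, ?_, ?_⟩
  · by_contra hcon
    push Not at hcon
    simp [hcon, Real.zero_rpow hq0.ne'] at hx1
  intro n hn
  have key : ∀ t : ℝ, 0 < t → ∑ m, A m n * (A.mulVec x m) ^ (q - 1) ≤ τ * (x n + t) ^ (q - 1) := by
    intro t ht
    let y : N → ℝ := x + Pi.single n t
    have hyn : y n = x n + t := by simp [y]
    have hyo : ∀ k, k ≠ n → y k = x k := fun k hk => by simp [y, hk]
    have hy0 : ∀ k, 0 ≤ y k := fun k => by
      by_cases hk : k = n
      · rw [hk, hyn]; linarith [hx0 n]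
      · rw [hyo k hk]; exact hx0 k
    have hyS : ∀ k ∈ S, y k = 0 := fun k hk => by
      rw [hyo k (fun h => hn (h ▸ hk))]; exact hxS k hk
    have hsum : ∑ k, y k ^ q = 1 + ((x n + t) ^ q - x n ^ q) := by
      rw [← hx1, ← Finset.add_sum_erase _ _ (Finset.mem_univ n),
        ← Finset.add_sum_erase _ (fun k => x k ^ q) (Finset.mem_univ n), hyn,
        Finset.sum_congr rfl (fun k hk => by rw [hyo k (Finset.ne_of_mem_erase hk)])]
      ring
    have hmono : x n ^ q ≤ (x n + t) ^ q := Real.rpow_le_rpow (hx0 n) (by linarith) hq0.le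
    have h := hom y hy0 hyS (by rw [hsum]; linarith)
    have hAy : ∀ m, A.mulVec y m = A.mulVec x m + A m n * t := fun m => by
      simp [y, Matrix.mulVec_add, mul_comm]
    have hlow : τ + q * t * ∑ m, A m n * (A.mulVec x m) ^ (q - 1) ≤ ∑ m, (A.mulVec y m) ^ q := by
      rw [hτ, Finset.mul_sum, ← Finset.sum_add_distrib]
      refine Finset.sum_le_sum fun m _ => ?_
      have := aux_tangent q (A.mulVec y m) (A.mulVec x m) hq (aux_mv_nonneg A hA y hy0 m)
        (aux_mv_nonneg A hA x hx0 m)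
      rw [hAy] at this ⊢
      linarith
    have hup := aux_tangent q (x n) (x n + t) hq (hx0 n) (by linarith [hx0 n])
    rw [hsum] at h
    have h5 : τ * ((x n + t) ^ q - x n ^ q) ≤ τ * (q * t * (x n + t) ^ (q - 1)) :=
      mul_le_mul_of_nonneg_left (by linarith) hτ0
    have hqt : 0 < q * t := mul_pos hq0 ht
    refine le_of_mul_le_mul_left ?_ hqt
    linarith
  have hlim : Filter.Tendsto (fun t : ℝ => τ * (x n + t) ^ (q - 1)) (nhdsWithin 0 (Set.Ioi 0))
      (nhds (τ * (x n + 0) ^ (q - 1))) := by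
    have : Continuous fun t : ℝ => τ * (x n + t) ^ (q - 1) :=
      continuous_const.mul ((continuous_const.add continuous_id).rpow_const
        fun _ => Or.inr (by linarith))
    exact (this.tendsto 0).mono_left nhdsWithin_le_nhds
  have h := ge_of_tendsto hlim (by
    filter_upwards [self_mem_nhdsWithin] with t ht
    exact key t ht)
  rw [add_zero] at h
  exact h.trans (mul_le_mul_of_nonneg_right hτC (Real.rpow_nonneg (hx0 n) _))

theorem aux_step {M N : Type*} [Fintype M] [Fintype N] (q C : ℝ) (hq : 1 < q)
    (A : Matrix M N ℝ) (hA : ∀ m n, 0 ≤ A m n)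
    (hC : ∀ x : N → ℝ, (∀ n, 0 ≤ x n) → ∑ m, (A.mulVec x m) ^ q ≤ C * ∑ n, x n ^ q)
    (v : N → ℝ) (hv : AuxSup q C A v) (n0 : N) (hn0 : v n0 = 0) :
    ∃ w : N → ℝ, AuxSup q C A w ∧ (∀ n, v n ≠ 0 → w n ≠ 0) ∧ ∃ n, v n = 0 ∧ w n ≠ 0 := by
  have hq1 : q - 1 ≠ 0 := by linarith
  obtain ⟨hv0, hv1⟩ := hv
  obtain ⟨x, hx0, hxS, ⟨n1, hn1⟩, hx⟩ := aux_max q C hq A hA hC {n | v n ≠ 0} n0 (by simp [hn0])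
  have hn1v : v n1 = 0 := by
    by_contra h
    exact hn1 (hxS n1 h)
  -- outside the support of v, entries vanish wherever Av is nonzero
  have hsep : ∀ n, v n = 0 → ∀ m, A m n ≠ 0 → A.mulVec v m = 0 := by
    intro n hn m hm
    have h := hv1 n
    rw [hn, Real.zero_rpow hq1, mul_zero] at h
    have hnn : ∀ m ∈ Finset.univ, 0 ≤ A m n * (A.mulVec v m) ^ (q - 1) := fun m _ =>
      mul_nonneg (hA m n) (Real.rpow_nonneg (aux_mv_nonneg A hA v hv0 m) _)
    have h2 := (Finset.sum_eq_zero_iff_of_nonneg hnn).mp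
      (le_antisymm h (Finset.sum_nonneg hnn)) m (Finset.mem_univ m)
    rcases mul_eq_zero.mp h2 with h3 | h3
    · exact absurd h3 hm
    · exact ((Real.rpow_eq_zero (aux_mv_nonneg A hA v hv0 m) hq1).mp h3)
  have hsep2 : ∀ n, v n ≠ 0 → ∀ m, A m n ≠ 0 → A.mulVec x m = 0 := by
    intro n hn m hm
    refine Finset.sum_eq_zero fun k _ => ?_
    by_cases hk : v k = 0
    · by_cases hmk : A m k = 0
      · simp [hmk]
      · have := aux_mv_zero A hA v hv0 m (hsep k hk m hmk) n
        rcases mul_eq_zero.mp this with h | h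
        · exact absurd h hm
        · exact absurd h hn
    · simp [hxS k hk]
  refine ⟨v + x, ⟨fun n => add_nonneg (hv0 n) (hx0 n), fun n => ?_⟩, fun n hn => ?_, n1, hn1v, ?_⟩
  · by_cases hn : v n = 0
    · have e : ∑ m, A m n * (A.mulVec (v + x) m) ^ (q - 1)
          = ∑ m, A m n * (A.mulVec x m) ^ (q - 1) := by
        refine Finset.sum_congr rfl fun m _ => ?_
        by_cases hm : A m n = 0
        · simp [hm]
        · rw [Matrix.mulVec_add, Pi.add_apply, hsep n hn m hm, zero_add]
      rw [e, Pi.add_apply, hn, zero_add]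
      exact hx n (by simp [hn])
    · have e : ∑ m, A m n * (A.mulVec (v + x) m) ^ (q - 1)
          = ∑ m, A m n * (A.mulVec v m) ^ (q - 1) := by
        refine Finset.sum_congr rfl fun m _ => ?_
        by_cases hm : A m n = 0
        · simp [hm]
        · rw [Matrix.mulVec_add, Pi.add_apply, hsep2 n hn m hm, add_zero]
      rw [e, Pi.add_apply, hxS n hn, add_zero]
      exact hv1 n
  · rw [Pi.add_apply, hxS n hn, add_zero]; exact hn
  · rw [Pi.add_apply, hn1v, zero_add]; exact hn1

theorem aux_main {M N : Type*} [Fintype M] [Fintype N] (q C : ℝ) (hq : 1 < q)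
    (A : Matrix M N ℝ) (hA : ∀ m n, 0 ≤ A m n)
    (hC : ∀ x : N → ℝ, (∀ n, 0 ≤ x n) → ∑ m, (A.mulVec x m) ^ q ≤ C * ∑ n, x n ^ q) :
    ∃ v : N → ℝ, AuxSup q C A v ∧ ∀ n, 0 < v n := by
  classical
  have hq1 : q - 1 ≠ 0 := by linarith
  have ind : ∀ k : ℕ, k ≤ Fintype.card N → ∃ v : N → ℝ, AuxSup q C A v ∧
      k ≤ (Finset.univ.filter fun n => v n ≠ 0).card := by
    intro k
    induction k with
    | zero =>
      intro _
      exact ⟨0, ⟨fun n => le_rfl, fun n => by simp [Real.zero_rpow hq1]⟩, Nat.zero_le _⟩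
    | succ k ih =>
      intro hk
      obtain ⟨v, hv, hc⟩ := ih (by omega)
      by_cases hall : ∀ n, v n ≠ 0
      · refine ⟨v, hv, ?_⟩
        rw [Finset.filter_true_of_mem fun n _ => hall n]
        exact hk
      · push Not at hall
        obtain ⟨n0, hn0⟩ := hall
        obtain ⟨w, hw, h1, n1, h2, h3⟩ := aux_step q C hq A hA hC v hv n0 hn0
        refine ⟨w, hw, ?_⟩
        refine Nat.succ_le_of_lt (lt_of_le_of_lt hc (Finset.card_lt_card ?_))
        refine Finset.ssubset_iff_of_subset (fun n hn => ?_) |>.mpr ⟨n1, by simp [h3], by simp [h2]⟩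
        simp only [Finset.mem_filter, Finset.mem_univ, true_and] at hn ⊢
        exact h1 n hn
  obtain ⟨v, hv, hc⟩ := ind _ le_rfl
  refine ⟨v, hv, fun n => lt_of_le_of_ne (hv.1 n) (Ne.symm ?_)⟩
  have : (Finset.univ.filter fun n => v n ≠ 0) = Finset.univ :=
    Finset.eq_univ_of_card _ (le_antisymm (Finset.card_le_univ _) hc)
  have hm := Finset.mem_univ n
  rw [← this] at hm
  exact (Finset.mem_filter.mp hm).2

/-- Generalized singular vectors of an arbitrary nonnegative matrix
(Theorem `thm:uAv_pos` of the paper): for conjugate exponents `p, q ∈ (1,∞)` there are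
entrywise strictly positive `u`, `v` with `(Aᵀu)_n ≤ v_n^(q/p) ⬝ ‖A‖_{q→q}` and
`(Av)_m ≤ u_m^(p/q) ⬝ ‖A‖_{q→q}`. -/
theorem stmt17 (p q : ℝ) (hp : 1 < p) (hq : 1 < q) (hpq : 1 / p + 1 / q = 1)
    {M N : Type*} [Fintype M] [Fintype N]
    (A : Matrix M N ℝ) (hA : ∀ m n, 0 ≤ A m n) :
    ∃ (u : M → ℝ) (v : N → ℝ), (∀ m, 0 < u m) ∧ (∀ n, 0 < v n) ∧
      (∀ n, A.transpose.mulVec u n ≤ v n ^ (q / p) * opNormR q A) ∧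
      (∀ m, A.mulVec v m ≤ u m ^ (p / q) * opNormR q A) := by
  classical
  have hp0 : 0 < p := by linarith
  have hq0 : 0 < q := by linarith
  obtain ⟨hσ0, hσ⟩ := aux_op q hq A
  set σ := opNormR q A with hσdef
  have hC : ∀ x : N → ℝ, (∀ n, 0 ≤ x n) →
      ∑ m, (A.mulVec x m) ^ q ≤ σ ^ q * ∑ n, x n ^ q := by
    intro x hx
    have h := hσ x
    simp_rw [fun m => abs_of_nonneg (aux_mv_nonneg A hA x hx m),
      fun n => abs_of_nonneg (hx n)] at h
    exact h
  have hsum : q + p = p * q := by field_simp at hpq; linarith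
  have e1 : q / p = q - 1 := by field_simp; linarith
  have e2 : (q - 1) * (p / q) = 1 := by field_simp; linarith
  rcases hσ0.eq_or_lt with h0 | hpos
  · have hAz : ∀ m n, A m n = 0 := by
      intro m n
      have h := hC (fun _ => 1) (fun _ => zero_le_one)
      rw [← h0, Real.zero_rpow hq0.ne', zero_mul] at h
      have hnn : ∀ m ∈ Finset.univ, 0 ≤ (A.mulVec (fun _ => 1) m) ^ q := fun m _ =>
        Real.rpow_nonneg (aux_mv_nonneg A hA _ (fun _ => zero_le_one) m) _
      have h2 := (Finset.sum_eq_zero_iff_of_nonneg hnn).mp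
        (le_antisymm h (Finset.sum_nonneg hnn)) m (Finset.mem_univ m)
      have h3 := (Real.rpow_eq_zero
        (aux_mv_nonneg A hA _ (fun _ => zero_le_one) m) hq0.ne').mp h2
      simpa using aux_mv_zero A hA _ (fun _ => zero_le_one) m h3 n
    refine ⟨fun _ => 1, fun _ => 1, fun _ => one_pos, fun _ => one_pos, fun n => ?_, fun m => ?_⟩
    · simp [Matrix.mulVec, dotProduct, hAz, hσ0]
    · simp [Matrix.mulVec, dotProduct, hAz, hσ0]
  · obtain ⟨v, ⟨hv0, hv⟩, hvpos⟩ := aux_main q (σ ^ q) hq A hA hC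
    have hAv := aux_mv_nonneg A hA v hv0
    refine ⟨fun m => if A.mulVec v m = 0 then 1 else (A.mulVec v m / σ) ^ (q - 1), v,
      fun m => ?_, hvpos, fun n => ?_, fun m => ?_⟩
    · dsimp only
      split_ifs with h
      · exact one_pos
      · exact Real.rpow_pos_of_pos (div_pos (lt_of_le_of_ne (hAv m) (Ne.symm h)) hpos) _
    · have e : A.transpose.mulVec (fun m => if A.mulVec v m = 0 then 1 else
          (A.mulVec v m / σ) ^ (q - 1)) n
          = (∑ m, A m n * (A.mulVec v m) ^ (q - 1)) / σ ^ (q - 1) := by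
        rw [Finset.sum_div]
        refine Finset.sum_congr rfl fun m _ => ?_
        simp only [Matrix.transpose_apply]
        split_ifs with h
        · have : A m n = 0 := by
            rcases mul_eq_zero.mp (aux_mv_zero A hA v hv0 m h n) with h' | h'
            · exact h'
            · exact absurd h' (hvpos n).ne'
          simp [this]
        · rw [Real.div_rpow (hAv m) hσ0, mul_div_assoc]
      rw [e, e1, div_le_iff₀ (Real.rpow_pos_of_pos hpos _)]
      refine (hv n).trans (le_of_eq ?_)
      have : σ ^ q = σ ^ (q - 1) * σ := by
        rw [← Real.rpow_add_one hpos.ne']; congr 1; ring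
      rw [this]; ring
    · dsimp only
      split_ifs with h
      · rw [h, Real.one_rpow, one_mul]; exact hσ0
      · rw [← Real.rpow_mul (div_nonneg (hAv m) hσ0), e2, Real.rpow_one,
          div_mul_cancel₀ _ hpos.ne']
end
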